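/- If the free deterministic max-product system x_{k+1} = A ⊠ x_k is exponentially stable, then the controlled system x_{k+1} = (A ⊠ x_k) ∨ (B ⊠ u_k) is input-to-state stable: there exist a class KL function β and a class K function α such that ‖x_k‖ ≤ β(‖x_0‖, k) + α(max_{0≤i≤k} ‖u_i‖) for every initial condition, every k, and every input sequence u_k. -/

import Mathlib

open scoped NNReal
open Filter

/-- Max-product of a matrix over ℝ₊ = [0,∞) with a vector:
`(A ⊠ x)_i = max_j A_{ij} x_j`. -/
noncomputable def mpMulVec {n m : ℕ} (A : Fin n → Fin m → ℝ≥0) (x : Fin m → ℝ≥0) :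
    Fin n → ℝ≥0 :=
  fun i => Finset.univ.sup fun j => A i j * x j

/-- Infinity norm of a nonnegative vector: `‖x‖ = max_i x_i`. -/
noncomputable def vnorm {n : ℕ} (x : Fin n → ℝ≥0) : ℝ≥0 :=
  Finset.univ.sup x

/-- The trajectory of the deterministic max-product system `x_{k+1} = A ⊠ x_k`. -/
noncomputable def mpTraj {n : ℕ} (A : Fin n → Fin n → ℝ≥0) (x0 : Fin n → ℝ≥0) :
    ℕ → Fin n → ℝ≥0
  | 0 => x0
  | k + 1 => mpMulVec A (mpTraj A x0 k)

/-- Exponential stability of `x_{k+1} = A ⊠ x_k`. -/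
def ExpStable {n : ℕ} (A : Fin n → Fin n → ℝ≥0) : Prop :=
  ∃ a L : ℝ≥0, 1 < a ∧ 0 < L ∧
    ∀ (x0 : Fin n → ℝ≥0) (k : ℕ), vnorm (mpTraj A x0 k) ≤ L * vnorm x0 / a ^ k

/-- A class 𝒦 function: increasing with `α(0) = 0`. -/
def ClassK (α : ℝ≥0 → ℝ≥0) : Prop :=
  StrictMono α ∧ α 0 = 0

/-- A class 𝒦ℒ function: `β(·,t)` is class 𝒦 for each `t`, and `β(s,·)` is decreasing
with `β(s,t) → 0` as `t → ∞`. -/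
def ClassKL (β : ℝ≥0 → ℝ≥0 → ℝ≥0) : Prop :=
  (∀ t, ClassK fun s => β s t) ∧
  ∀ s, Antitone (β s) ∧ Tendsto (β s) atTop (nhds 0)

theorem vnorm_sup {n : ℕ} (x y : Fin n → ℝ≥0) : vnorm (x ⊔ y) = vnorm x ⊔ vnorm y :=
  Finset.sup_sup

theorem mpMulVec_sup {n m : ℕ} (A : Fin n → Fin m → ℝ≥0) (x y : Fin m → ℝ≥0) :
    mpMulVec A (x ⊔ y) = mpMulVec A x ⊔ mpMulVec A y := by
  funext i
  simp only [mpMulVec, Pi.sup_apply, mul_max]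
  exact Finset.sup_sup

theorem mpTraj_sup {n : ℕ} (A : Fin n → Fin n → ℝ≥0) (x y : Fin n → ℝ≥0) (k : ℕ) :
    mpTraj A (x ⊔ y) k = mpTraj A x k ⊔ mpTraj A y k := by
  induction k with
  | zero => rfl
  | succ k ih => simp only [mpTraj, ih, mpMulVec_sup]

theorem mpTraj_mpMulVec {n : ℕ} (A : Fin n → Fin n → ℝ≥0) (x : Fin n → ℝ≥0) (k : ℕ) :
    mpTraj A (mpMulVec A x) k = mpTraj A x (k + 1) := by
  induction k with
  | zero => rfl
  | succ k ih => rw [mpTraj, ih]; rfl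

theorem vnorm_mpMulVec_le {n m : ℕ} (B : Fin n → Fin m → ℝ≥0) (u : Fin m → ℝ≥0) :
    vnorm (mpMulVec B u) ≤ (vnorm fun i => vnorm (B i)) * vnorm u :=
  Finset.sup_le fun i hi => Finset.sup_le fun _ hj => mul_le_mul'
    ((Finset.le_sup (f := B i) hj).trans (Finset.le_sup (f := fun i => vnorm (B i)) hi))
    (Finset.le_sup (f := u) hj)

/-- Letting the free system run for `j` further steps makes induction on `k` go through. -/
theorem vnorm_mpTraj_controlled_le {n m : ℕ} {A : Fin n → Fin n → ℝ≥0}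
    {B : Fin n → Fin m → ℝ≥0} {a L : ℝ≥0} (ha : 1 ≤ a)
    (hA : ∀ (x0 : Fin n → ℝ≥0) (k : ℕ), vnorm (mpTraj A x0 k) ≤ L * vnorm x0 / a ^ k)
    {x : ℕ → Fin n → ℝ≥0} {u : ℕ → Fin m → ℝ≥0}
    (hx : ∀ k, x (k + 1) = mpMulVec A (x k) ⊔ mpMulVec B (u k)) (k j : ℕ) :
    vnorm (mpTraj A (x k) j) ≤ L * vnorm (x 0) / a ^ (k + j) ⊔
      L * (vnorm fun i => vnorm (B i)) * (Finset.range k).sup fun i => vnorm (u i) := by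
  induction k generalizing j with
  | zero => simpa using hA (x 0) j
  | succ k ih =>
    rw [hx, mpTraj_sup, mpTraj_mpMulVec, vnorm_sup]
    refine sup_le ((ih (j + 1)).trans (sup_le_sup ?_ ?_)) (le_sup_of_le_right ?_)
    · rw [add_right_comm, add_assoc]
    · gcongr
      exact Nat.le_succ k
    · calc vnorm (mpTraj A (mpMulVec B (u k)) j)
          ≤ L * vnorm (mpMulVec B (u k)) / a ^ j := hA _ j
        _ ≤ L * vnorm (mpMulVec B (u k)) := div_le_self zero_le (one_le_pow₀ ha)
        _ ≤ L * ((vnorm fun i => vnorm (B i)) * vnorm (u k)) := by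
            gcongr
            exact vnorm_mpMulVec_le B (u k)
        _ ≤ L * (vnorm fun i => vnorm (B i)) *
              (Finset.range (k + 1)).sup fun i => vnorm (u i) := by
            rw [← mul_assoc]
            gcongr
            exact Finset.le_sup (f := fun i => vnorm (u i)) (Finset.self_mem_range_succ k)

theorem classK_const_mul {c : ℝ≥0} (hc : 0 < c) : ClassK fun s => c * s :=
  ⟨fun _ _ h => mul_lt_mul_of_pos_left h hc, mul_zero c⟩

theorem classKL_exp {a L : ℝ≥0} (ha : 1 < a) (hL : 0 < L) :
    ClassKL fun s t => L * s / a ^ (t : ℝ) := by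
  have ha₀ : 0 < a := zero_lt_one.trans ha
  have ha₀' : (0 : ℝ) < a := ha₀
  refine ⟨fun t => ?_, fun s => ⟨fun t t' h => ?_, ?_⟩⟩
  · simpa only [mul_div_right_comm] using
      classK_const_mul (div_pos hL (NNReal.rpow_pos (p := (t : ℝ)) ha₀))
  · exact div_le_div_of_nonneg_left zero_le (NNReal.rpow_pos ha₀)
      (NNReal.rpow_le_rpow_of_exponent_le ha.le (NNReal.coe_le_coe.2 h))
  · rw [← NNReal.tendsto_coe]
    have h := (tendsto_rpow_atTop_of_base_lt_one ((a : ℝ)⁻¹) (by linarith [inv_pos.2 ha₀'])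
      (inv_lt_one_of_one_lt₀ (by exact_mod_cast ha))).comp
        (NNReal.tendsto_coe_atTop.2 tendsto_id)
    simpa [Function.comp_def, div_eq_mul_inv, Real.inv_rpow] using h.const_mul ((L : ℝ) * s)

/-- if the free system `x_{k+1} = A ⊠ x_k` is exponentially stable, then
`x_{k+1} = (A ⊠ x_k) ∨ (B ⊠ u_k)` is input-to-state stable: there are a class 𝒦ℒ
function β and a class 𝒦 function α with
`‖x_k‖ ≤ β(‖x_0‖, k) + α(max_{0≤i≤k} ‖u_i‖)` for every trajectory and input sequence. -/
theorem iss_of_expStable {n m : ℕ} (A : Fin n → Fin n → ℝ≥0) (B : Fin n → Fin m → ℝ≥0)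
    (hA : ExpStable A) :
    ∃ (β : ℝ≥0 → ℝ≥0 → ℝ≥0) (α : ℝ≥0 → ℝ≥0), ClassKL β ∧ ClassK α ∧
      ∀ (x : ℕ → Fin n → ℝ≥0) (u : ℕ → Fin m → ℝ≥0),
        (∀ k, x (k + 1) = fun i => mpMulVec A (x k) i ⊔ mpMulVec B (u k) i) →
        ∀ k : ℕ,
          vnorm (x k) ≤ β (vnorm (x 0)) (k : ℝ≥0) +
            α (Finset.sup (Finset.range (k + 1)) fun i => vnorm (u i)) := by
  obtain ⟨a, L, ha, hL, h⟩ := hA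
  refine ⟨fun s t => L * s / a ^ (t : ℝ), fun s => (L * (vnorm fun i => vnorm (B i)) + 1) * s,
    classKL_exp ha hL, classK_const_mul (by positivity), fun x u hx k => ?_⟩
  calc vnorm (x k)
      ≤ L * vnorm (x 0) / a ^ k ⊔
          L * (vnorm fun i => vnorm (B i)) * (Finset.range k).sup fun i => vnorm (u i) :=
        vnorm_mpTraj_controlled_le ha.le h hx k 0
    _ ≤ L * vnorm (x 0) / a ^ k +
          L * (vnorm fun i => vnorm (B i)) * (Finset.range k).sup fun i => vnorm (u i) :=
        max_le_add_of_nonneg zero_le zero_le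
    _ ≤ _ := by
        simp only [NNReal.coe_natCast, NNReal.rpow_natCast]
        gcongr
        · exact le_self_add
        · exact Nat.le_succ k
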